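/- Every rational Herglotz–Nevanlinna function m with a pole at zero admits a finite continued fraction expansion: there exist N ∈ ℕ, positive reals l₁,...,l_N, reals ω₁,...,ω_N, and nonnegative reals υ₁,...,υ_N such that m(z) = p_N(z)/q_N(z) off ℝ, where q₀ = 0, p₀ = 1, q_n(z) = q_{n-1}(z) - l_n z p_{n-1}(z), p_n(z) = p_{n-1}(z) + (ω_n + υ_n z) q_n(z). -/

import Mathlib

open Polynomial

/-- `P / Q` has nonnegative imaginary part on the upper half-plane, in a division-free form. -/
def IsHerglotzPair (P Q : ℝ[X]) : Prop :=
  ∀ z : ℂ, 0 < z.im → 0 ≤ (aeval z P * (starRingEnd ℂ) (aeval z Q)).im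

theorem im_div_eq_im_mul_conj_div_normSq (a b : ℂ) :
    (a / b).im = (a * (starRingEnd ℂ) b).im / Complex.normSq b := by
  rw [Complex.div_im, Complex.mul_im, Complex.conj_re, Complex.conj_im]
  ring

theorem im_mul_conj_nonneg_iff (a b : ℂ) :
    0 ≤ (a * (starRingEnd ℂ) b).im ↔ 0 ≤ (a / b).im := by
  rw [im_div_eq_im_mul_conj_div_normSq]
  rcases eq_or_ne b 0 with rfl | hb
  · simp
  · rw [le_div_iff₀ (Complex.normSq_pos.2 hb), zero_mul]

theorem IsHerglotzPair.im_div_nonneg {P Q : ℝ[X]} (h : IsHerglotzPair P Q) {z : ℂ}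
    (hz : 0 < z.im) : 0 ≤ (aeval z P / aeval z Q).im :=
  (im_mul_conj_nonneg_iff _ _).1 (h z hz)

/-- If `P / Q` is Herglotz then so is `-Q / P`. -/
theorem IsHerglotzPair.neg_swap {P Q : ℝ[X]} (h : IsHerglotzPair P Q) :
    IsHerglotzPair (-Q) P := by
  intro z hz
  have := h z hz
  simp only [Complex.mul_im, Complex.conj_re, Complex.conj_im, map_neg, Complex.neg_re,
    Complex.neg_im] at this ⊢
  linarith

/-- Adding a real constant to a Herglotz function. -/
theorem IsHerglotzPair.add_C_mul {P Q : ℝ[X]} (h : IsHerglotzPair P Q) (c : ℝ) :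
    IsHerglotzPair (P + C c * Q) Q := by
  intro z hz
  have := h z hz
  simp only [Complex.mul_im, Complex.conj_re, Complex.conj_im, map_add, map_mul, aeval_C,
    Complex.add_re, Complex.add_im, Complex.mul_re, Complex.coe_algebraMap, Complex.ofReal_re,
    Complex.ofReal_im] at this ⊢
  linarith

theorem tendsto_aeval_div_aeval_cobounded {P Q : ℝ[X]} (hQ : Q ≠ 0)
    (hPQ : P.natDegree ≤ Q.natDegree) :
    Filter.Tendsto (fun z : ℂ => aeval z P / aeval z Q) (Bornology.cobounded ℂ)
      (nhds ((P.coeff Q.natDegree / Q.leadingCoeff : ℝ) : ℂ)) := by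
  set n := Q.natDegree
  have key : Filter.Tendsto
      (fun w : ℂ => aeval w (reflect n P) / aeval w (reflect n Q)) (nhds 0)
      (nhds ((P.coeff n / Q.leadingCoeff : ℝ) : ℂ)) := by
    have hP0 : aeval (0 : ℂ) (reflect n P) = (P.coeff n : ℂ) := by
      rw [← coeff_zero_eq_aeval_zero', coeff_reflect]; simp
    have hQ0 : aeval (0 : ℂ) (reflect n Q) = (Q.leadingCoeff : ℂ) := by
      rw [← coeff_zero_eq_aeval_zero', coeff_reflect]; simp [n]
    have hQl : (Q.leadingCoeff : ℂ) ≠ 0 := by simpa using hQ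
    have h1 := (reflect n P).continuous_aeval (A := ℂ) |>.tendsto 0
    have h2 := (reflect n Q).continuous_aeval (A := ℂ) |>.tendsto 0
    rw [hP0] at h1
    rw [hQ0] at h2
    rw [Complex.ofReal_div]
    exact h1.div h2 hQl
  refine (key.comp Filter.tendsto_inv₀_cobounded).congr' ?_
  filter_upwards [Bornology.eventually_ne_cobounded (0 : ℂ)] with z hz
  let _ : Invertible z := invertibleOfNonzero hz
  have e1 := eval₂_reflect_mul_pow (algebraMap ℝ ℂ) z n P hPQ
  have e2 := eval₂_reflect_mul_pow (algebraMap ℝ ℂ) z n Q le_rfl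
  simp only [Function.comp, aeval_def, ← e1, ← e2, invOf_eq_inv]
  rw [mul_div_mul_right _ _ (pow_ne_zero _ hz)]

/-- A Herglotz function in lowest terms has no poles in the upper half-plane. -/
theorem IsHerglotzPair.aeval_ne_zero {P Q : ℝ[X]} (h : IsHerglotzPair P Q)
    (hcop : IsCoprime P Q) (hQ : Q ≠ 0) {z₀ : ℂ} (hz₀ : 0 < z₀.im) : aeval z₀ Q ≠ 0 := by
  intro hz
  have hP : aeval z₀ P ≠ 0 := by
    intro hP
    obtain ⟨a, b, hab⟩ := hcop
    have := congrArg (aeval z₀) hab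
    simp [hP, hz] at this
  have han (R : ℝ[X]) : AnalyticAt ℂ (fun z : ℂ => aeval z R) z₀ :=
    AnalyticAt.aeval_polynomial analyticAt_id R
  have hf : AnalyticAt ℂ (fun z : ℂ => aeval z Q / aeval z P) z₀ := (han Q).div (han P) hP
  have hup : ∀ᶠ z : ℂ in nhds z₀, 0 < z.im :=
    Complex.continuous_im.continuousAt.eventually (lt_mem_nhds hz₀)
  rcases hf.eventually_constant_or_nhds_le_map_nhds with hc | ho
  · have hroots : ∀ᶠ z : ℂ in nhds z₀, aeval z Q = 0 := by
      filter_upwards [hc, (han P).continuousAt.eventually_ne hP] with z h1 h2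
      rw [hz, zero_div, div_eq_zero_iff] at h1
      exact h1.resolve_right h2
    have hinf : {z : ℂ | aeval z Q = 0}.Infinite :=
      infinite_of_mem_nhds z₀ hroots
    have hQ' : Q.map (algebraMap ℝ ℂ) ≠ 0 :=
      (Polynomial.map_ne_zero_iff (algebraMap ℝ ℂ).injective).2 hQ
    refine hQ' (eq_zero_of_infinite_isRoot _ (hinf.mono fun z hz => ?_))
    simpa [IsRoot, eval_map_algebraMap] using hz
  · have hle : ∀ᶠ z : ℂ in nhds z₀, (aeval z Q / aeval z P).im ≤ 0 := by
      filter_upwards [hup] with z hz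
      have := h.neg_swap.im_div_nonneg hz
      rw [map_neg, neg_div, Complex.neg_im] at this
      linarith
    have hle' : ∀ᶠ w : ℂ in nhds 0, w.im ≤ 0 := by
      have := ho (show {w : ℂ | w.im ≤ 0} ∈ _ from hle)
      rwa [hz, zero_div] at this
    have ht : Filter.Tendsto (fun t : ℝ => (t : ℂ) * Complex.I) (nhdsWithin 0 (Set.Ioi 0))
        (nhds 0) := by
      have : Continuous fun t : ℝ => (t : ℂ) * Complex.I := by fun_prop
      simpa using (this.tendsto 0).mono_left nhdsWithin_le_nhds
    obtain ⟨t, h1, h2⟩ := ((ht.eventually hle').and self_mem_nhdsWithin).exists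
    simp at h1 h2
    linarith

/-- A function that is holomorphic on the upper half-plane, tends to zero at infinity, and whose
imaginary part is bounded below by `-υ * im z`, has nonnegative imaginary part. -/
theorem im_nonneg_of_tendsto_zero_cobounded {f : ℂ → ℂ} {υ : ℝ} (hυ : 0 ≤ υ)
    (hf : ∀ z : ℂ, 0 < z.im → DifferentiableAt ℂ f z)
    (hlim : Filter.Tendsto f (Bornology.cobounded ℂ) (nhds 0))
    (him : ∀ z : ℂ, 0 < z.im → -(υ * z.im) ≤ (f z).im) {z₀ : ℂ} (hz₀ : 0 < z₀.im) :
    0 ≤ (f z₀).im := by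
  refine le_of_forall_pos_le_add fun δ hδ => ?_
  obtain ⟨R, -, hR⟩ := (Filter.hasBasis_cobounded_norm (E := ℂ)).eventually_iff.1
    (hlim.eventually (Metric.ball_mem_nhds 0 hδ))
  obtain ⟨ε, hε, hεz, hευ⟩ : ∃ ε : ℝ, 0 < ε ∧ ε < z₀.im ∧ υ * ε ≤ δ := by
    refine ⟨min (z₀.im / 2) (δ / (υ + 1)), by positivity, ?_, ?_⟩
    · exact (min_le_left _ _).trans_lt (by linarith)
    · calc υ * min (z₀.im / 2) (δ / (υ + 1)) ≤ (υ + 1) * (δ / (υ + 1)) :=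
            mul_le_mul (by linarith) (min_le_right _ _) (by positivity) (by positivity)
        _ = δ := by field_simp
  set S := max R (‖z₀‖ + 1)
  set U : Set ℂ := {z | ε < z.im} ∩ Metric.ball 0 S
  have hUo : IsOpen U := (isOpen_lt continuous_const Complex.continuous_im).inter Metric.isOpen_ball
  have hUc : closure U ⊆ {z | ε ≤ z.im} :=
    closure_minimal (fun z hz => le_of_lt (show ε < z.im from hz.1)) (isClosed_le continuous_const Complex.continuous_im)
  have hd : DiffContOnCl ℂ (fun z => Complex.exp (Complex.I * f z)) U :=
    DifferentiableOn.diffContOnCl fun z hz =>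
      (((hf z (hε.trans_le (hUc hz))).const_mul _).cexp).differentiableWithinAt
  have hnorm (z : ℂ) : ‖Complex.exp (Complex.I * f z)‖ = Real.exp (-(f z).im) := by
    rw [Complex.norm_exp]; simp
  have hfr : ∀ z ∈ frontier U, ‖Complex.exp (Complex.I * f z)‖ ≤ Real.exp δ := by
    intro z hz
    rw [hnorm, Real.exp_le_exp]
    have hzε : ε ≤ z.im := hUc hz.1
    have hzU : z ∉ U := by have := hz.2; rwa [hUo.interior_eq] at this
    by_cases hzi : ε < z.im
    · have hzS : S ≤ ‖z‖ := by
        by_contra! hlt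
        exact hzU ⟨hzi, by simpa using hlt⟩
      have h1 : ‖f z‖ < δ := by simpa using hR (show R ≤ ‖z‖ from (le_max_left _ _).trans hzS)
      linarith [(abs_le.1 (Complex.abs_im_le_norm (f z))).1]
    · have hze : z.im = ε := le_antisymm (not_lt.1 hzi) hzε
      have := him z (hε.trans_le hzε)
      rw [hze] at this
      linarith
  have hmem : z₀ ∈ U := ⟨hεz, by
    rw [mem_ball_zero_iff]
    exact (lt_add_one ‖z₀‖).trans_le (le_max_right R (‖z₀‖ + 1))⟩
  have := Complex.norm_le_of_forall_mem_frontier_norm_le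
    (Metric.isBounded_ball.subset Set.inter_subset_right) hd hfr (subset_closure hmem)
  rw [hnorm, Real.exp_le_exp] at this
  linarith

/-- The leading behaviour at infinity of a Herglotz function of positive degree at infinity. -/
theorem IsHerglotzPair.im_leadingCoeff_div_mul_pow_nonneg {P Q : ℝ[X]} (h : IsHerglotzPair P Q)
    (hQ : Q ≠ 0) {k : ℕ} (hk : P.natDegree = Q.natDegree + k) {ζ : ℂ} (hζ : 0 < ζ.im) :
    0 ≤ P.leadingCoeff / Q.leadingCoeff * (ζ ^ k).im := by
  have hXQ : (X ^ k * Q).natDegree = P.natDegree := by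
    rw [natDegree_X_pow_mul _ hQ, hk]
  have hlim := tendsto_aeval_div_aeval_cobounded (P := P) (Q := X ^ k * Q)
    (mul_ne_zero (pow_ne_zero _ X_ne_zero) hQ) hXQ.ge
  rw [hXQ, leadingCoeff_mul, leadingCoeff_X_pow, one_mul] at hlim
  have hζ0 : ζ ≠ 0 := by rintro rfl; simp at hζ
  have hray : Filter.Tendsto (fun r : ℝ => (r : ℂ) * ζ) Filter.atTop (Bornology.cobounded ℂ) := by
    rw [← tendsto_norm_atTop_iff_cobounded]
    simp only [norm_mul, Complex.norm_real]
    exact (tendsto_norm_atTop_atTop).atTop_mul_const (norm_pos_iff.2 hζ0)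
  have hlim' := (Complex.continuous_im.tendsto _).comp ((hlim.comp hray).mul_const (ζ ^ k))
  rw [Complex.im_ofReal_mul] at hlim'
  refine ge_of_tendsto hlim' ?_
  filter_upwards [Filter.eventually_gt_atTop 0] with r hr
  have him : 0 < ((r : ℂ) * ζ).im := by rw [Complex.im_ofReal_mul]; positivity
  have hpos := h.im_div_nonneg him
  have hrC : (r : ℂ) ≠ 0 := by exact_mod_cast hr.ne'
  have heq : aeval ((r : ℂ) * ζ) P / aeval ((r : ℂ) * ζ) (X ^ k * Q) * ζ ^ k =
      (((r ^ k)⁻¹ : ℝ) : ℂ) * (aeval ((r : ℂ) * ζ) P / aeval ((r : ℂ) * ζ) Q) := by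
    rw [map_mul, map_pow, aeval_X, mul_pow]
    push_cast
    field_simp
  simp only [Function.comp]
  rw [heq, Complex.im_ofReal_mul]
  positivity

theorem IsHerglotzPair.le_one_of_natDegree_eq {P Q : ℝ[X]} (h : IsHerglotzPair P Q)
    (hP : P ≠ 0) (hQ : Q ≠ 0) {k : ℕ} (hk : P.natDegree = Q.natDegree + k) : k ≤ 1 := by
  by_contra! hk2
  have hk2' : (2 : ℝ) ≤ k := by exact_mod_cast hk2
  have hk0 : (k : ℝ) ≠ 0 := by positivity
  set c := P.leadingCoeff / Q.leadingCoeff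
  have hc : c ≠ 0 := div_ne_zero (leadingCoeff_ne_zero.2 hP) (leadingCoeff_ne_zero.2 hQ)
  have key (θ : ℝ) (h0 : 0 < θ) (h1 : θ < Real.pi) : 0 ≤ c * Real.sin (k * θ) := by
    have him : (Complex.exp (θ * Complex.I)).im = Real.sin θ := Complex.exp_ofReal_mul_I_im θ
    have := h.im_leadingCoeff_div_mul_pow_nonneg hQ hk (ζ := Complex.exp (θ * Complex.I))
      (by rw [him]; exact Real.sin_pos_of_pos_of_lt_pi h0 h1)
    rw [← Complex.exp_nat_mul, ← mul_assoc] at this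
    have e := Complex.exp_ofReal_mul_I_im (k * θ)
    push_cast at e
    rwa [e] at this
  have hpi := Real.pi_pos
  have h1 := key (Real.pi / 2 / k) (by positivity) (by
    rw [div_lt_iff₀ (by positivity)]; nlinarith)
  have h2 := key ((Real.pi / 2 + Real.pi) / k) (by positivity) (by
    rw [div_lt_iff₀ (by positivity)]; nlinarith)
  rw [mul_div_cancel₀ _ hk0, Real.sin_pi_div_two] at h1
  rw [mul_div_cancel₀ _ hk0, Real.sin_add_pi, Real.sin_pi_div_two] at h2
  exact hc (by linarith)

/-- Splitting off the linear part at infinity of a Herglotz function. -/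
theorem IsHerglotzPair.exists_linear_part {P Q : ℝ[X]} (h : IsHerglotzPair P Q)
    (hcop : IsCoprime P Q) (hQ : Q ≠ 0) :
    ∃ (ω υ : ℝ) (R : ℝ[X]), 0 ≤ υ ∧ P = R + (C ω + C υ * X) * Q ∧
      R.degree < Q.degree ∧ IsHerglotzPair R Q := by
  have hdiv : Q * (P / Q) + P % Q = P := EuclideanDomain.div_add_mod P Q
  have hmod : (P % Q).degree < Q.degree := degree_mod_lt P hQ
  set A := P / Q
  set R := P % Q
  have hdeg (hA : A ≠ 0) : P.natDegree = Q.natDegree + A.natDegree ∧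
      P.leadingCoeff = Q.leadingCoeff * A.leadingCoeff := by
    have hlt : R.degree < (Q * A).degree :=
      hmod.trans_le (degree_le_mul_left Q hA)
    rw [← hdiv, natDegree_add_eq_left_of_degree_lt hlt, natDegree_mul hQ hA,
      leadingCoeff_add_of_degree_lt' hlt, leadingCoeff_mul]
    exact ⟨rfl, rfl⟩
  have hA1 : A.natDegree ≤ 1 := by
    by_cases hA : A = 0
    · simp [hA]
    · have hP : P ≠ 0 := by
        rw [← leadingCoeff_ne_zero, (hdeg hA).2]
        exact mul_ne_zero (leadingCoeff_ne_zero.2 hQ) (leadingCoeff_ne_zero.2 hA)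
      exact h.le_one_of_natDegree_eq hP hQ (hdeg hA).1
  have hυ : 0 ≤ A.coeff 1 := by
    by_cases hA : A.coeff 1 = 0
    · exact hA.ge
    · have hA0 : A ≠ 0 := by rintro h0; simp [h0] at hA
      have hAd : A.natDegree = 1 := le_antisymm hA1 (le_natDegree_of_ne_zero hA)
      have := h.im_leadingCoeff_div_mul_pow_nonneg hQ (hdeg hA0).1 (ζ := Complex.I) (by simp)
      rw [(hdeg hA0).2, mul_div_cancel_left₀ _ (leadingCoeff_ne_zero.2 hQ), leadingCoeff,
        hAd] at this
      simpa using this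
  have hAeq : A = C (A.coeff 0) + C (A.coeff 1) * X := by
    rw [add_comm]; exact eq_X_add_C_of_natDegree_le_one hA1
  have hPeq : P = R + (C (A.coeff 0) + C (A.coeff 1) * X) * Q := by
    rw [← hAeq, mul_comm A, add_comm, hdiv]
  refine ⟨A.coeff 0, A.coeff 1, R, hυ, hPeq, hmod, fun z₀ hz₀ => ?_⟩
  have hne {z : ℂ} (hz : 0 < z.im) : aeval z Q ≠ 0 := h.aeval_ne_zero hcop hQ hz
  rw [im_mul_conj_nonneg_iff]
  refine im_nonneg_of_tendsto_zero_cobounded (f := fun z : ℂ => aeval z R / aeval z Q) hυ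
    (fun z hz => ?_) ?_ (fun z hz => ?_) hz₀
  · exact (R.differentiable_aeval z).div (Q.differentiable_aeval z) (hne hz)
  · have := tendsto_aeval_div_aeval_cobounded hQ (natDegree_le_natDegree hmod.le)
    rwa [coeff_eq_zero_of_degree_lt (hmod.trans_eq (degree_eq_natDegree hQ)), zero_div,
      Complex.ofReal_zero] at this
  · have := h.im_div_nonneg hz
    rw [hPeq, map_add, map_mul, add_div, mul_div_cancel_right₀ _ (hne hz)] at this
    simp at this
    linarith

/-- One step of the continued fraction algorithm. -/
theorem IsHerglotzPair.exists_step {P Q : ℝ[X]} (h : IsHerglotzPair P Q)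
    (hcop : IsCoprime P Q) (hQ : Q ≠ 0) (hQ0 : Q.eval 0 = 0) (hP0 : P.eval 0 ≠ 0) :
    ∃ (l ω υ : ℝ) (P' Q' : ℝ[X]), 0 < l ∧ 0 ≤ υ ∧
      Q = Q' - C l * X * P' ∧ P = P' + (C ω + C υ * X) * Q ∧
      Q'.natDegree < Q.natDegree ∧ IsCoprime P' Q' ∧ Q'.eval 0 = 0 ∧ P'.eval 0 ≠ 0 ∧
      IsHerglotzPair P' Q' := by
  obtain ⟨ω, υ, P', hυ, hP, hdeg, hH⟩ := h.exists_linear_part hcop hQ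
  have hP'0 : P'.eval 0 ≠ 0 := by
    rw [hP] at hP0
    simpa [hQ0] using hP0
  have hP'ne : P' ≠ 0 := by rintro rfl; simp at hP'0
  have hcop' : IsCoprime P' Q := by
    rw [hP] at hcop
    exact IsCoprime.of_add_mul_right_left hcop
  obtain ⟨c, l, R, hl, hQR, hRdeg, hRH⟩ := hH.neg_swap.exists_linear_part hcop'.symm.neg_left hP'ne
  set Q' : ℝ[X] := -(R + C c * P')
  have hQeq : Q = Q' - C l * X * P' := by
    linear_combination (-1 : ℝ[X]) * hQR
  have hQ'deg : Q'.degree ≤ P'.degree := by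
    rw [degree_neg]
    refine (degree_add_le _ _).trans (max_le hRdeg.le ?_)
    rw [C_mul']
    exact degree_smul_le c P'
  have hl0 : l ≠ 0 := by
    rintro rfl
    rw [hQeq] at hdeg
    simp at hdeg
    exact absurd hdeg hQ'deg.not_gt
  refine ⟨l, ω, υ, P', Q', hl.lt_of_ne' hl0, hυ, hQeq, hP, ?_, ?_, ?_, hP'0, ?_⟩
  · exact (natDegree_le_natDegree hQ'deg).trans_lt (natDegree_lt_natDegree hP'ne hdeg)
  · have : Q' = Q + P' * (C l * X) := by linear_combination -hQeq
    rw [this]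
    exact hcop'.add_mul_left_right _
  · have := congrArg (eval 0) hQeq
    simpa [hQ0] using this.symm
  · have := (hRH.add_C_mul c).neg_swap
    intro z hz
    have h1 := this z hz
    simp only [Q', map_neg, neg_mul, mul_neg] at h1 ⊢
    exact h1

/-- Every Herglotz pair with a pole at zero is, up to a constant factor, given by the continued
fraction recursion. -/
theorem IsHerglotzPair.exists_continued_fraction {P Q : ℝ[X]} (h : IsHerglotzPair P Q)
    (hcop : IsCoprime P Q) (hQ0 : Q.eval 0 = 0) (hP0 : P.eval 0 ≠ 0) :
    ∃ (N : ℕ) (l ω υ : ℕ → ℝ) (p q : ℕ → ℝ[X]) (c : ℝ), c ≠ 0 ∧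
      (∀ n ∈ Finset.Icc 1 N, 0 < l n) ∧ (∀ n ∈ Finset.Icc 1 N, 0 ≤ υ n) ∧
      q 0 = 0 ∧ p 0 = 1 ∧
      (∀ n ∈ Finset.Icc 1 N,
        q n = q (n - 1) - C (l n) * X * p (n - 1) ∧
        p n = p (n - 1) + (C (ω n) + C (υ n) * X) * q n) ∧
      P = C c * p N ∧ Q = C c * q N := by
  induction hd : Q.natDegree using Nat.strong_induction_on generalizing P Q with
  | _ d ih =>
  by_cases hQ : Q = 0
  · subst hQ
    obtain ⟨c, hc, rfl⟩ := isUnit_iff.1 (isCoprime_zero_right.1 hcop)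
    exact ⟨0, 0, 0, 0, 1, 0, c, hc.ne_zero, by simp⟩
  · obtain ⟨l', ω', υ', P', Q', hl', hυ', hQe, hPe, hdeg, hcop', hQ'0, hP'0, hH⟩ :=
      h.exists_step hcop hQ hQ0 hP0
    obtain ⟨N, l, ω, υ, p, q, c, hc, hl, hυ, hq, hp, hrec, hPc, hQc⟩ :=
      ih _ (hd ▸ hdeg) hH hcop' hQ'0 hP'0 rfl
    set qNext : ℝ[X] := q N - C l' * X * p N
    set pNext : ℝ[X] := p N + (C ω' + C υ' * X) * qNext
    have hQc' : Q = C c * qNext := by rw [hQe, hPc, hQc]; ring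
    have hPc' : P = C c * pNext := by rw [hPe, hPc, hQc']; ring
    have hIcc (n : ℕ) (hn : n ∈ Finset.Icc 1 (N + 1)) : n ∈ Finset.Icc 1 N ∨ n = N + 1 := by
      simp only [Finset.mem_Icc] at hn ⊢; omega
    have hne (n : ℕ) (hn : n ∈ Finset.Icc 1 N) : n ≠ N + 1 ∧ n - 1 ≠ N + 1 := by
      simp only [Finset.mem_Icc] at hn; omega
    refine ⟨N + 1, Function.update l (N + 1) l', Function.update ω (N + 1) ω',
      Function.update υ (N + 1) υ', Function.update p (N + 1) pNext, Function.update q (N + 1) qNext, c,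
      hc, fun n hn => ?_, fun n hn => ?_, by simpa using hq, by simpa using hp, fun n hn => ?_,
      by simpa using hPc', by simpa using hQc'⟩
    · rcases hIcc n hn with hn | rfl
      · simpa [hne n hn] using hl n hn
      · simpa using hl'
    · rcases hIcc n hn with hn | rfl
      · simpa [hne n hn] using hυ n hn
      · simpa using hυ'
    · rcases hIcc n hn with hn | rfl
      · simpa [hne n hn] using hrec n hn
      · simp [qNext, pNext]

/-- Every rational Herglotz–Nevanlinna function `m = P/Q` with a
pole at zero admits a finite continued fraction expansion: there are `N ∈ ℕ`,
positive reals `l₁,…,l_N`, reals `ω₁,…,ω_N` and nonnegative reals `υ₁,…,υ_N`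
such that `m(z) = p_N(z)/q_N(z)` off `ℝ`, where `q₀ = 0`, `p₀ = 1`,
`q_n = q_{n-1} - l_n z p_{n-1}`, `p_n = p_{n-1} + (ω_n + υ_n z) q_n`. -/
theorem rational_herglotz_continued_fraction
    (P Q : Polynomial ℝ) (hQ : Q ≠ 0)
    (hcop : IsCoprime P Q)
    (hpole : Q.eval 0 = 0) (hP0 : P.eval 0 ≠ 0)
    (hherg : ∀ z : ℂ, 0 < z.im →
      0 ≤ ((Polynomial.aeval z P) / (Polynomial.aeval z Q)).im) :
    ∃ (N : ℕ) (l ω υ : ℕ → ℝ), 1 ≤ N ∧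
      (∀ n ∈ Finset.Icc 1 N, 0 < l n) ∧
      (∀ n ∈ Finset.Icc 1 N, 0 ≤ υ n) ∧
      ∃ p q : ℕ → Polynomial ℝ,
        q 0 = 0 ∧ p 0 = 1 ∧
        (∀ n ∈ Finset.Icc 1 N,
          q n = q (n - 1) - Polynomial.C (l n) * Polynomial.X * p (n - 1) ∧
          p n = p (n - 1) + (Polynomial.C (ω n) + Polynomial.C (υ n) * Polynomial.X) * q n) ∧
        ∀ z : ℂ, z.im ≠ 0 →
          (Polynomial.aeval z P) / (Polynomial.aeval z Q) =
            (Polynomial.aeval z (p N)) / (Polynomial.aeval z (q N)) := by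
  obtain ⟨N, l, ω, υ, p, q, c, hc, hl, hυ, hq, hp, hrec, hPc, hQc⟩ :=
    IsHerglotzPair.exists_continued_fraction
      (fun z hz => (im_mul_conj_nonneg_iff _ _).2 (hherg z hz)) hcop hpole hP0
  refine ⟨N, l, ω, υ, ?_, hl, hυ, p, q, hq, hp, hrec, fun z _ => ?_⟩
  · rw [Nat.one_le_iff_ne_zero]
    rintro rfl
    exact hQ (by rw [hQc, hq, mul_zero])
  · rw [hPc, hQc, map_mul, map_mul, aeval_C]
    exact mul_div_mul_left _ _ (by simpa using hc)
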